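/- arXiv:2102.10261 — 4 statements merged into one kernel-verified Lean document; each statement's English description precedes it below -/
import Mathlib

section
/- In the rounding process with LP-feasible x, for every bin i and time t, the probability that bin i is matched along a late edge before time t satisfies P[O^L_{i,t}] ≤ 4c. -/
open Finset

noncomputable section
open scoped Classical

namespace Rounding

/-- A configuration of all the randomness used by the rounding process: arrival
indicators `A_t`, first picks `I¹_t`, second picks `I²_t`, and acceptance coins
`Y_{i,t}`. -/
abbrev Cfg (m n : ℕ) :=
  (Fin n → Bool) × (Fin n → Fin m) × (Fin n → Fin m) × (Fin m → Fin n → Bool)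

/-- The constant `c = 1/100`. -/
def c : ℝ := 1 / 100

variable (m n : ℕ)

/-- `S x i t = ∑_{t' < t} x i t'`. -/
def S (x : Fin m → Fin n → ℝ) (i : Fin m) (t : Fin n) : ℝ :=
  ∑ t' ∈ Finset.univ.filter fun t' : Fin n => t' < t, x i t'

/-- LP-feasibility of `x` (with arrival probabilities `p t ∈ (0,1]`, every
constraint `∑_i x i t = p t` tight). -/
def LPFeasible (p : Fin n → ℝ) (x : Fin m → Fin n → ℝ) : Prop :=
  (∀ t, 0 < p t ∧ p t ≤ 1) ∧
  (∀ i t, 0 ≤ x i t) ∧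
  (∀ i, ∑ t, x i t ≤ 1) ∧
  (∀ t, ∑ i, x i t = p t) ∧
  (∀ i t, x i t ≤ p t * (1 - S m n x i t))

/-- Edge `(i,t)` is early if `∑_{t' < t} x i t' ≤ (1/2 − c)/(1/2 + c)`. -/
def Early (x : Fin m → Fin n → ℝ) (i : Fin m) (t : Fin n) : Prop :=
  S m n x i t ≤ (1/2 - c) / (1/2 + c)

/-- Edge `(i,t)` is late if it is not early. -/
def Late (x : Fin m → Fin n → ℝ) (i : Fin m) (t : Fin n) : Prop :=
  ¬ Early m n x i t

/-- The acceptance probability `q_{i,t}`. -/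
def q (x : Fin m → Fin n → ℝ) (i : Fin m) (t : Fin n) : ℝ :=
  min 1 ((1/2 + c) / (1 - (1/2 + c) * S m n x i t))

/-- The probability of a configuration: the product of the probabilities of all
the mutually independent components (`P(A_t = 1) = p_t`,
`P(I¹_t = i) = P(I²_t = i) = x_{i,t}/p_t`, `P(Y_{i,t} = 1) = q_{i,t}`). -/
def weight (p : Fin n → ℝ) (x : Fin m → Fin n → ℝ) (cfg : Cfg m n) : ℝ :=
  (∏ t, if cfg.1 t then p t else 1 - p t) *
  (∏ t, x (cfg.2.1 t) t / p t) *
  (∏ t, x (cfg.2.2.1 t) t / p t) *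
  ∏ i, ∏ t, if cfg.2.2.2 i t then q m n x i t else 1 - q m n x i t

/-- Probability of an event. -/
def Pr (p : Fin n → ℝ) (x : Fin m → Fin n → ℝ) (E : Set (Cfg m n)) : ℝ :=
  ∑ cfg : Cfg m n, if cfg ∈ E then weight m n p x cfg else 0

/-- Conditional probability of `E` given `F`. -/
def condPr (p : Fin n → ℝ) (x : Fin m → Fin n → ℝ) (E F : Set (Cfg m n)) : ℝ :=
  Pr m n p x (E ∩ F) / Pr m n p x F

/-- Bin `i` is unmatched in the partial matching `M`. -/
def FreeBin (M : Finset (Fin m × Fin n)) (i : Fin m) : Prop :=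
  ∀ t, (i, t) ∉ M

/-- `proc x cfg t = (M₁, M₂)`: the two parts of the matching built by the rounding
process after processing all times `< t`.  At each time `t`, if ball `t` arrives,
its first pick `I¹_t` is unmatched, and the coin `Y_{I¹_t,t}` comes up heads, then
`(I¹_t, t)` is added to `M₁`; otherwise, if ball `t` arrives, its second pick
`I²_t` is unmatched, and edge `(I²_t, t)` is late, then `(I²_t, t)` is added
to `M₂`. -/
def proc (x : Fin m → Fin n → ℝ) (cfg : Cfg m n) :
    ℕ → Finset (Fin m × Fin n) × Finset (Fin m × Fin n)
  | 0 => (∅, ∅)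
  | (t + 1) =>
    let P := proc x cfg t
    if h : t < n then
      let T : Fin n := ⟨t, h⟩
      let M := P.1 ∪ P.2
      if cfg.1 T = true ∧ FreeBin m n M (cfg.2.1 T) ∧ cfg.2.2.2 (cfg.2.1 T) T = true then
        (insert (cfg.2.1 T, T) P.1, P.2)
      else if cfg.1 T = true ∧ FreeBin m n M (cfg.2.2.1 T) ∧ Late m n x (cfg.2.2.1 T) T then
        (P.1, insert (cfg.2.2.1 T, T) P.2)
      else P
    else P

/-- The final matching `M₁` (edges matched on a first pick). -/
def M1F (x : Fin m → Fin n → ℝ) (cfg : Cfg m n) : Finset (Fin m × Fin n) :=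
  (proc m n x cfg n).1

/-- The final matching `M₂` (edges matched on a second pick). -/
def M2F (x : Fin m → Fin n → ℝ) (cfg : Cfg m n) : Finset (Fin m × Fin n) :=
  (proc m n x cfg n).2

/-- The final matching `M = M₁ ∪ M₂`. -/
def MF (x : Fin m → Fin n → ℝ) (cfg : Cfg m n) : Finset (Fin m × Fin n) :=
  M1F m n x cfg ∪ M2F m n x cfg

/-- `V_{i,t}`: the event that bin `i` is unmatched before time `t`. -/
def V (x : Fin m → Fin n → ℝ) (i : Fin m) (t : Fin n) : Set (Cfg m n) :=
  {cfg | FreeBin m n ((proc m n x cfg t.1).1 ∪ (proc m n x cfg t.1).2) i}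

/-- `O_{i,t}`: the event that bin `i` is matched before time `t`. -/
def O (x : Fin m → Fin n → ℝ) (i : Fin m) (t : Fin n) : Set (Cfg m n) :=
  (V m n x i t)ᶜ

/-- `O^E_{i,t}`: the event that bin `i` is matched along an early edge before time `t`. -/
def OE (x : Fin m → Fin n → ℝ) (i : Fin m) (t : Fin n) : Set (Cfg m n) :=
  {cfg | ∃ t' : Fin n, Early m n x i t' ∧
    (i, t') ∈ (proc m n x cfg t.1).1 ∪ (proc m n x cfg t.1).2}

/-- `O^L_{i,t}`: the event that bin `i` is matched along a late edge before time `t`. -/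
def OL (x : Fin m → Fin n → ℝ) (i : Fin m) (t : Fin n) : Set (Cfg m n) :=
  {cfg | ∃ t' : Fin n, Late m n x i t' ∧
    (i, t') ∈ (proc m n x cfg t.1).1 ∪ (proc m n x cfg t.1).2}

/-- `U₁(t)`: the event that ball `t` is not matched in the first-pick step at time `t`. -/
def U1 (x : Fin m → Fin n → ℝ) (t : Fin n) : Set (Cfg m n) :=
  {cfg | ∀ i, (i, t) ∉ (proc m n x cfg (t.1 + 1)).1}

/-- The event that ball `t` arrives (`A_t = 1`). -/
def EvA (t : Fin n) : Set (Cfg m n) := {cfg | cfg.1 t = true}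

/-- The event that the first pick of ball `t` is bin `j` (`I¹_t = j`). -/
def EvI1 (j : Fin m) (t : Fin n) : Set (Cfg m n) := {cfg | cfg.2.1 t = j}

/-- Under a finite product weight normalised at `t`, a function of coordinate `t` is
independent of any function that does not depend on that coordinate. -/
theorem sum_pi_weight_mul {ι β : Type*} [Fintype ι] [DecidableEq ι] [Fintype β]
    (w : ι → β → ℝ) (t : ι) (hw : ∑ b, w t b = 1) (f : (ι → β) → ℝ)
    (hf : ∀ ω ω', (∀ s, s ≠ t → ω s = ω' s) → f ω = f ω') (g : β → ℝ) :
    ∑ ω : ι → β, (∏ s, w s (ω s)) * (f ω * g (ω t)) =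
      (∑ ω : ι → β, (∏ s, w s (ω s)) * f ω) * ∑ b, w t b * g b := by
  have hne : Nonempty β := by
    by_contra h
    rw [not_nonempty_iff] at h
    simp at hw
  obtain ⟨b₀⟩ := hne
  let e := Equiv.funSplitAt t β
  have hfe (b : β) (r : {j // j ≠ t} → β) : f (e.symm (b, r)) = f (e.symm (b₀, r)) :=
    hf _ _ fun s hs => by simp [e, Equiv.funSplitAt, Equiv.piSplitAt, hs]
  have hprod (b : β) (r : {j // j ≠ t} → β) :
      ∏ s, w s (e.symm (b, r) s) = w t b * ∏ s : {j // j ≠ t}, w s (r s) := by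
    rw [Fintype.prod_eq_mul_prod_subtype_ne _ t]
    congr 1
    · simp [e, Equiv.funSplitAt, Equiv.piSplitAt]
    · refine Finset.prod_congr rfl fun s _ => ?_
      simp [e, Equiv.funSplitAt, Equiv.piSplitAt, s.2]
  have ht (b : β) (r : {j // j ≠ t} → β) : e.symm (b, r) t = b := by
    simp [e, Equiv.funSplitAt, Equiv.piSplitAt]
  rw [← e.symm.sum_comp, ← e.symm.sum_comp (fun ω : ι → β => (∏ s, w s (ω s)) * f ω)]
  simp only [Fintype.sum_prod_type, hprod, ht, hfe]
  simp only [mul_assoc, ← Finset.mul_sum, ← Finset.sum_mul, hw, one_mul]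
  rw [Finset.mul_sum]
  refine Finset.sum_congr rfl fun b _ => ?_
  simp only [← mul_assoc, ← Finset.sum_mul]
  ring

/-- A finite product of normalised weights has total mass one. -/
theorem sum_pi_weight_eq_one {ι β : Type*} [Fintype ι] [DecidableEq ι] [Fintype β]
    (w : ι → β → ℝ) (hw : ∀ t, ∑ b, w t b = 1) :
    ∑ ω : ι → β, ∏ s, w s (ω s) = 1 := by
  have h := Finset.prod_univ_sum (fun _ : ι => (Finset.univ : Finset β)) w
  rw [Fintype.piFinset_univ] at h
  rw [← h]
  simp [hw]

/-- The randomness attached to a single ball: arrival, first pick, second pick and the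
acceptance coins of its edges. -/
abbrev BallCfg (m : ℕ) := Bool × Fin m × Fin m × (Fin m → Bool)

/-- Regroup a configuration ball by ball. -/
def ballEquiv : Cfg m n ≃ (Fin n → BallCfg m) where
  toFun cfg t := (cfg.1 t, cfg.2.1 t, cfg.2.2.1 t, fun i => cfg.2.2.2 i t)
  invFun ω := (fun t => (ω t).1, fun t => (ω t).2.1, fun t => (ω t).2.2.1,
    fun i t => (ω t).2.2.2 i)
  left_inv _ := rfl
  right_inv _ := rfl

/-- The weight of the randomness of ball `t`. -/
def ballWeight (p : Fin n → ℝ) (x : Fin m → Fin n → ℝ) (t : Fin n) (b : BallCfg m) : ℝ :=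
  (if b.1 then p t else 1 - p t) * ((x b.2.1 t / p t) * ((x b.2.2.1 t / p t) *
    ∏ i, if b.2.2.2 i then q m n x i t else 1 - q m n x i t))

variable {m n}

theorem weight_eq_prod_ballWeight (p : Fin n → ℝ) (x : Fin m → Fin n → ℝ) (cfg : Cfg m n) :
    weight m n p x cfg = ∏ t, ballWeight m n p x t (ballEquiv m n cfg t) := by
  simp only [ballWeight, Finset.prod_mul_distrib]
  rw [weight, Finset.prod_comm (s := (Finset.univ : Finset (Fin m))), mul_assoc, mul_assoc]
  rfl

/-- Weighted sums over the randomness of one ball factor over its components. -/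
theorem sum_ballWeight_mul (p : Fin n → ℝ) (x : Fin m → Fin n → ℝ) (t : Fin n)
    (f : Bool → ℝ) (g h : Fin m → ℝ) (k : (Fin m → Bool) → ℝ) :
    ∑ b, ballWeight m n p x t b * (f b.1 * (g b.2.1 * (h b.2.2.1 * k b.2.2.2))) =
      (∑ a, (if a then p t else 1 - p t) * f a) * ((∑ j, x j t / p t * g j) *
        ((∑ j, x j t / p t * h j) *
          ∑ y : Fin m → Bool, (∏ i, if y i then q m n x i t else 1 - q m n x i t) * k y)) := by
  calc _ = ∑ a, ∑ j, ∑ j', ∑ y : Fin m → Bool, ((if a then p t else 1 - p t) * f a) *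
        ((x j t / p t * g j) * ((x j' t / p t * h j') *
          ((∏ i, if y i then q m n x i t else 1 - q m n x i t) * k y))) := by
        simp only [Fintype.sum_prod_type, ballWeight]
        refine Finset.sum_congr rfl fun a _ => Finset.sum_congr rfl fun j _ =>
          Finset.sum_congr rfl fun j' _ => Finset.sum_congr rfl fun y _ => ?_
        ring
    _ = _ := by simp only [← Finset.mul_sum, ← Finset.sum_mul]

theorem sum_coin_eq_one (x : Fin m → Fin n → ℝ) (t : Fin n) :
    ∑ y : Fin m → Bool, (∏ i, if y i then q m n x i t else 1 - q m n x i t) = 1 :=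
  sum_pi_weight_eq_one (fun i b => if b = true then q m n x i t else 1 - q m n x i t)
    fun i => by simp

theorem sum_coin_mul (x : Fin m → Fin n → ℝ) (i : Fin m) (t : Fin n) :
    ∑ y : Fin m → Bool, (∏ i, if y i then q m n x i t else 1 - q m n x i t) *
      (if y i then 1 else 0) = q m n x i t := by
  have h := sum_pi_weight_mul
    (fun i b => if b = true then q m n x i t else 1 - q m n x i t) i (by simp)
    (fun _ => 1) (fun _ _ _ => rfl) (fun b => if b then 1 else 0)
  simp only [one_mul, mul_one] at h
  rw [h, sum_coin_eq_one]
  simp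

namespace LPFeasible

variable {p : Fin n → ℝ} {x : Fin m → Fin n → ℝ}

theorem sum_pick (hx : LPFeasible m n p x) (t : Fin n) : ∑ j, x j t / p t = 1 := by
  rw [← Finset.sum_div, hx.2.2.2.1 t, div_self (hx.1 t).1.ne']

theorem sum_ballWeight (hx : LPFeasible m n p x) (t : Fin n) :
    ∑ b, ballWeight m n p x t b = 1 := by
  have h := sum_ballWeight_mul p x t (fun _ => 1) (fun _ => 1) (fun _ => 1) (fun _ => 1)
  simp only [mul_one] at h
  rw [h, sum_coin_eq_one, hx.sum_pick]
  simp

theorem sum_ballWeight_accept (hx : LPFeasible m n p x) (i : Fin m) (t : Fin n) :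
    ∑ b, ballWeight m n p x t b *
      (if b.1 = true ∧ b.2.1 = i ∧ b.2.2.2 i = true then 1 else 0) = x i t * q m n x i t := by
  have h := sum_ballWeight_mul p x t (fun a => if a then 1 else 0)
    (fun j => if j = i then 1 else 0) (fun _ => 1) (fun y => if y i then 1 else 0)
  rw [sum_coin_mul] at h
  simp only [mul_one, one_mul, hx.sum_pick] at h
  have hp := (hx.1 t).1.ne'
  calc _ = _ := by
        refine Finset.sum_congr rfl fun b _ => ?_
        simp only [ite_and, ite_mul, one_mul, zero_mul]
    _ = _ := h
    _ = _ := by simp; field_simp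

theorem sum_ballWeight_first (hx : LPFeasible m n p x) (i : Fin m) (t : Fin n) :
    ∑ b, ballWeight m n p x t b * (if b.1 = true ∧ b.2.1 = i then 1 else 0) = x i t := by
  have h := sum_ballWeight_mul p x t (fun a => if a then 1 else 0)
    (fun j => if j = i then 1 else 0) (fun _ => 1) (fun _ => 1)
  simp only [mul_one, hx.sum_pick, sum_coin_eq_one] at h
  have hp := (hx.1 t).1.ne'
  calc _ = _ := by
        refine Finset.sum_congr rfl fun b _ => ?_
        simp only [ite_and, ite_mul, one_mul, zero_mul]
    _ = _ := h
    _ = _ := by simp; field_simp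

theorem sum_ballWeight_second (hx : LPFeasible m n p x) (i : Fin m) (t : Fin n) :
    ∑ b, ballWeight m n p x t b * (if b.1 = true ∧ b.2.2.1 = i then 1 else 0) = x i t := by
  have h := sum_ballWeight_mul p x t (fun a => if a then 1 else 0) (fun _ => 1)
    (fun j => if j = i then 1 else 0) (fun _ => 1)
  simp only [one_mul, mul_one, hx.sum_pick, sum_coin_eq_one] at h
  have hp := (hx.1 t).1.ne'
  calc _ = _ := by
        refine Finset.sum_congr rfl fun b _ => ?_
        simp only [ite_and, ite_mul, one_mul, zero_mul]
    _ = _ := h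
    _ = _ := by simp; field_simp

theorem one_sub_mul_S_pos (hx : LPFeasible m n p x) (i : Fin m) (t : Fin n) :
    0 < 1 - (1/2 + c) * S m n x i t := by
  have h : S m n x i t ≤ 1 := (Finset.sum_le_sum_of_subset_of_nonneg (Finset.filter_subset _ _)
    fun j _ _ => hx.2.1 i j).trans (hx.2.2.1 i)
  unfold c
  linarith

theorem q_nonneg (hx : LPFeasible m n p x) (i : Fin m) (t : Fin n) : 0 ≤ q m n x i t :=
  le_min zero_le_one (div_nonneg (by norm_num [c]) (hx.one_sub_mul_S_pos i t).le)

theorem weight_nonneg (hx : LPFeasible m n p x) (cfg : Cfg m n) : 0 ≤ weight m n p x cfg := by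
  have hx0 (j : Fin m) (t : Fin n) : 0 ≤ x j t / p t := div_nonneg (hx.2.1 j t) (hx.1 t).1.le
  refine mul_nonneg (mul_nonneg (mul_nonneg ?_ ?_) ?_) ?_
  · refine Finset.prod_nonneg fun t _ => ?_
    have := hx.1 t
    split_ifs <;> linarith
  · exact Finset.prod_nonneg fun t _ => hx0 _ t
  · exact Finset.prod_nonneg fun t _ => hx0 _ t
  · refine Finset.prod_nonneg fun i _ => Finset.prod_nonneg fun t _ => ?_
    have h0 := hx.q_nonneg i t
    have h1 : q m n x i t ≤ 1 := min_le_left _ _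
    split_ifs <;> linarith

theorem Pr_univ (hx : LPFeasible m n p x) : Pr m n p x Set.univ = 1 := by
  simp only [Pr, Set.mem_univ, if_true, weight_eq_prod_ballWeight]
  rw [(ballEquiv m n).sum_comp (fun ω => ∏ t, ballWeight m n p x t (ω t))]
  exact sum_pi_weight_eq_one _ hx.sum_ballWeight

theorem Pr_mono (hx : LPFeasible m n p x) {E F : Set (Cfg m n)} (h : E ⊆ F) :
    Pr m n p x E ≤ Pr m n p x F := by
  refine Finset.sum_le_sum fun cfg _ => ?_
  have := hx.weight_nonneg cfg
  by_cases hE : cfg ∈ E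
  · simp [hE, h hE]
  · rw [if_neg hE]
    split_ifs <;> simp [this]

theorem Pr_union_le (hx : LPFeasible m n p x) (E F : Set (Cfg m n)) :
    Pr m n p x (E ∪ F) ≤ Pr m n p x E + Pr m n p x F := by
  simp only [Pr, ← Finset.sum_add_distrib]
  refine Finset.sum_le_sum fun cfg _ => ?_
  have := hx.weight_nonneg cfg
  by_cases hE : cfg ∈ E <;> by_cases hF : cfg ∈ F <;> simp [hE, hF, this]

/-- An event not depending on ball `t` is independent of the randomness of ball `t`. -/
theorem Pr_inter_ball (hx : LPFeasible m n p x) {F : Set (Cfg m n)} (t : Fin n)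
    (hF : ∀ cfg cfg' : Cfg m n,
      (∀ s, s ≠ t → ballEquiv m n cfg s = ballEquiv m n cfg' s) → (cfg ∈ F ↔ cfg' ∈ F))
    (B : BallCfg m → Prop) [DecidablePred B] :
    Pr m n p x (F ∩ {cfg | B (ballEquiv m n cfg t)}) =
      Pr m n p x F * ∑ b, ballWeight m n p x t b * (if B b then 1 else 0) := by
  have h := sum_pi_weight_mul (ballWeight m n p x) t (hx.sum_ballWeight t)
    (fun ω => if (ballEquiv m n).symm ω ∈ F then 1 else 0)
    (fun ω ω' hω => by
      have := hF ((ballEquiv m n).symm ω) ((ballEquiv m n).symm ω') (by simpa using hω)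
      simp only [this])
    (fun b => if B b then 1 else 0)
  rw [← (ballEquiv m n).sum_comp (fun ω : Fin n → BallCfg m => (∏ s, ballWeight m n p x s (ω s)) *
      ((if (ballEquiv m n).symm ω ∈ F then 1 else 0) * if B (ω t) then 1 else 0)),
    ← (ballEquiv m n).sum_comp (fun ω : Fin n → BallCfg m =>
    (∏ s, ballWeight m n p x s (ω s)) * if (ballEquiv m n).symm ω ∈ F then 1 else 0)] at h
  simp only [Equiv.symm_apply_apply, ← weight_eq_prod_ballWeight] at h
  simp only [Pr]
  convert h using 2
  · simp only [Set.mem_inter_iff, Set.mem_ofPred_eq, ite_and]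
    split_ifs <;> simp
  · simp

end LPFeasible

/-- The process up to time `k` only depends on the balls before time `k`. -/
theorem proc_congr (x : Fin m → Fin n → ℝ) {cfg cfg' : Cfg m n} {k : ℕ}
    (h : ∀ s : Fin n, s.1 < k → ballEquiv m n cfg s = ballEquiv m n cfg' s) :
    proc m n x cfg k = proc m n x cfg' k := by
  induction k with
  | zero => rfl
  | succ k ih =>
    have ih' := ih fun s hs => h s (by omega)
    by_cases hk : k < n
    · have hb := h ⟨k, hk⟩ (by simp)
      simp only [ballEquiv, Equiv.coe_fn_mk, Prod.mk.injEq, funext_iff] at hb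
      obtain ⟨h1, h2, h3, h4⟩ := hb
      simp only [proc, hk, dite_true, ih', h1, h2, h3, h4]
    · simp only [proc, hk, dite_false, ih']

/-- The event that bin `i` is unmatched before time `k`. -/
def freeBefore (x : Fin m → Fin n → ℝ) (i : Fin m) (k : ℕ) : Set (Cfg m n) :=
  {cfg | FreeBin m n ((proc m n x cfg k).1 ∪ (proc m n x cfg k).2) i}

/-- The event that bin `i` is matched along a late edge before time `k`. -/
def lateBefore (x : Fin m → Fin n → ℝ) (i : Fin m) (k : ℕ) : Set (Cfg m n) :=
  {cfg | ∃ t' : Fin n, Late m n x i t' ∧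
    (i, t') ∈ (proc m n x cfg k).1 ∪ (proc m n x cfg k).2}

theorem mem_freeBefore_congr (x : Fin m → Fin n → ℝ) (i : Fin m) (t : Fin n)
    (cfg cfg' : Cfg m n)
    (h : ∀ s, s ≠ t → ballEquiv m n cfg s = ballEquiv m n cfg' s) :
    cfg ∈ freeBefore x i t ↔ cfg' ∈ freeBefore x i t := by
  simp only [freeBefore, Set.mem_ofPred_eq,
    proc_congr x fun s (hs : s.1 < t.1) => h s (Fin.ne_of_lt hs)]

theorem freeBefore_succ_subset (x : Fin m → Fin n → ℝ) (i : Fin m) (t : Fin n) :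
    freeBefore x i (t + 1) ⊆ freeBefore x i t ∧
    ∀ cfg ∈ freeBefore x i (t + 1),
      ¬ (cfg.1 t = true ∧ cfg.2.1 t = i ∧ cfg.2.2.2 i t = true) := by
  have key : ∀ cfg ∈ freeBefore x i (t + 1), cfg ∈ freeBefore x i t := by
    intro cfg h s hs
    refine h s ?_
    simp only [proc, t.2, dite_true]
    split_ifs <;> simp only [Finset.mem_union, Finset.mem_insert] at hs ⊢ <;> tauto
  refine ⟨key, ?_⟩
  rintro cfg h ⟨h1, rfl, h3⟩
  have hf := key cfg h
  refine h t ?_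
  simp only [freeBefore, Set.mem_ofPred_eq] at hf
  simp [proc, h1, h3, hf]

theorem lateBefore_succ_subset_of_early {x : Fin m → Fin n → ℝ} {i : Fin m} {t : Fin n}
    (ht : Early m n x i t) : lateBefore x i (t + 1) ⊆ lateBefore x i t := by
  rintro cfg ⟨s, hs, hm⟩
  refine ⟨s, hs, ?_⟩
  have hst : s ≠ t := by
    rintro rfl
    exact hs ht
  simp only [proc, t.2, dite_true] at hm
  split_ifs at hm <;>
    simp only [Finset.mem_union, Finset.mem_insert, Prod.mk.injEq, Fin.eta, hst,
      and_false, false_or] at hm ⊢ <;> exact hm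

theorem lateBefore_succ_subset (x : Fin m → Fin n → ℝ) (i : Fin m) (t : Fin n) :
    lateBefore x i (t + 1) ⊆ lateBefore x i t ∪
      (freeBefore x i t ∩ {cfg | cfg.1 t = true ∧ cfg.2.1 t = i} ∪
        freeBefore x i t ∩ {cfg | cfg.1 t = true ∧ cfg.2.2.1 t = i}) := by
  rintro cfg ⟨s, hs, hm⟩
  by_cases hold : (i, s) ∈ (proc m n x cfg t).1 ∪ (proc m n x cfg t).2
  · exact Or.inl ⟨s, hs, hold⟩
  right
  simp only [proc, t.2, dite_true] at hm
  simp only [Finset.mem_union, not_or] at hold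
  split_ifs at hm with h1 h2
  · simp only [Finset.mem_union, Finset.mem_insert, Prod.mk.injEq, hold, or_false] at hm
    obtain ⟨rfl, rfl⟩ := hm
    exact Or.inl ⟨h1.2.1, h1.1, rfl⟩
  · simp only [Finset.mem_union, Finset.mem_insert, Prod.mk.injEq, hold, or_false,
      false_or] at hm
    obtain ⟨rfl, rfl⟩ := hm
    exact Or.inr ⟨h2.2.1, h2.1, rfl⟩
  · simp [hold] at hm

/-- The LP mass `∑_{t' < k} x i t'` of bin `i` before time `k`. -/
def massBefore (x : Fin m → Fin n → ℝ) (i : Fin m) (k : ℕ) : ℝ :=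
  ∑ t' : Fin n with t'.1 < k, x i t'

theorem massBefore_succ (x : Fin m → Fin n → ℝ) (i : Fin m) (t : Fin n) :
    massBefore x i (t + 1) = massBefore x i t + x i t := by
  have h : (Finset.univ.filter fun t' : Fin n => t'.1 < t.1 + 1) =
      insert t (Finset.univ.filter fun t' : Fin n => t'.1 < t.1) := by
    ext s
    simp only [Finset.mem_filter, Finset.mem_univ, true_and, Finset.mem_insert, Fin.ext_iff]
    omega
  rw [massBefore, h, Finset.sum_insert (by simp), add_comm]
  rfl

namespace LPFeasible

variable {p : Fin n → ℝ} {x : Fin m → Fin n → ℝ}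

theorem Pr_freeBefore_succ_le (hx : LPFeasible m n p x) (i : Fin m) (t : Fin n) :
    Pr m n p x (freeBefore x i (t + 1)) ≤
      Pr m n p x (freeBefore x i t) * (1 - x i t * q m n x i t) := by
  obtain ⟨hsub, hno⟩ := freeBefore_succ_subset x i t
  have h := hx.Pr_inter_ball t (mem_freeBefore_congr x i t)
    (fun b => b.1 = true ∧ b.2.1 = i ∧ b.2.2.2 i = true)
  rw [hx.sum_ballWeight_accept i t] at h
  let B : BallCfg m → Prop := fun b => b.1 = true ∧ b.2.1 = i ∧ b.2.2.2 i = true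
  have hadd : Pr m n p x (freeBefore x i (t + 1)) +
      Pr m n p x (freeBefore x i t ∩ {cfg | B (ballEquiv m n cfg t)}) ≤
        Pr m n p x (freeBefore x i t) := by
    simp only [Pr, ← Finset.sum_add_distrib]
    refine Finset.sum_le_sum fun cfg _ => ?_
    have hw := hx.weight_nonneg cfg
    by_cases hF : cfg ∈ freeBefore x i (t + 1)
    · have hB : ¬ B (ballEquiv m n cfg t) := hno cfg hF
      simp [hF, hsub hF, hB]
    · by_cases hF' : cfg ∈ freeBefore x i t <;>
        by_cases hB : B (ballEquiv m n cfg t) <;> simp [hF, hF', hB, hw]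
  have h' : Pr m n p x (freeBefore x i t ∩ {cfg | B (ballEquiv m n cfg t)}) = _ := h
  linarith

theorem Pr_freeBefore_le (hx : LPFeasible m n p x) (i : Fin m) {k : ℕ} (hk : k ≤ n) :
    Pr m n p x (freeBefore x i k) ≤ max (1/2 + c) (1 - (1/2 + c) * massBefore x i k) := by
  induction k with
  | zero =>
    refine le_max_of_le_right ?_
    simpa [massBefore, hx.Pr_univ] using hx.Pr_mono (Set.subset_univ (freeBefore x i 0))
  | succ k ih =>
    let t : Fin n := ⟨k, hk⟩
    specialize ih (by omega)
    have hstep := hx.Pr_freeBefore_succ_le i t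
    have hpos := hx.one_sub_mul_S_pos i t
    have hmass := massBefore_succ x i t
    change Pr m n p x (freeBefore x i k) ≤
      max (1/2 + c) (1 - (1/2 + c) * S m n x i t) at ih
    change massBefore x i (k + 1) = S m n x i t + x i t at hmass
    by_cases hE : Early m n x i t
    · refine le_max_of_le_right ?_
      rw [Early, le_div_iff₀ (by norm_num [c])] at hE
      rw [max_eq_right (by linarith)] at ih
      have hq : q m n x i t = (1/2 + c) / (1 - (1/2 + c) * S m n x i t) :=
        min_eq_right ((div_le_one hpos).2 (by linarith))
      have hxq : 0 ≤ 1 - x i t * q m n x i t := by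
        have h1 : q m n x i t ≤ 1 := min_le_left _ _
        have h2 : x i t ≤ 1 := by
          have := Finset.single_le_sum (fun s _ => hx.2.1 i s) (Finset.mem_univ t)
          exact this.trans (hx.2.2.1 i)
        have := mul_le_one₀ h2 (hx.q_nonneg i t) h1
        linarith
      calc _ ≤ _ := hstep
        _ ≤ (1 - (1/2 + c) * S m n x i t) * (1 - x i t * q m n x i t) := by
          exact mul_le_mul_of_nonneg_right ih hxq
        _ = _ := by
          have h := mul_div_cancel₀ (1/2 + c) hpos.ne'
          rw [hmass, hq]
          linear_combination (-x i t) * h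
    · refine le_max_of_le_left ?_
      rw [Early, not_le, div_lt_iff₀ (by norm_num [c])] at hE
      rw [max_eq_left (by linarith)] at ih
      exact (hx.Pr_mono (freeBefore_succ_subset x i t).1).trans ih

theorem Pr_lateBefore_le (hx : LPFeasible m n p x) (i : Fin m) {k : ℕ} (hk : k ≤ n) :
    Pr m n p x (lateBefore x i k) ≤
      2 * max 0 ((1/2 + c) * massBefore x i k - (1/2 - c)) := by
  induction k with
  | zero =>
    have h : lateBefore x i 0 = ∅ := by
      ext cfg
      simp [lateBefore, proc]
    simp [h, Pr]
  | succ k ih =>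
    let t : Fin n := ⟨k, hk⟩
    have hfree := hx.Pr_freeBefore_le i (k := k) (by omega)
    specialize ih (by omega)
    have hmass : massBefore x i (k + 1) = massBefore x i k + x i t := massBefore_succ x i t
    have hx0 := hx.2.1 i t
    have hE : Early m n x i t ↔ (1/2 + c) * massBefore x i k ≤ 1/2 - c := by
      rw [Early, le_div_iff₀ (by norm_num [c]), mul_comm]
      rfl
    by_cases ht : Early m n x i t
    · refine (hx.Pr_mono (lateBefore_succ_subset_of_early ht)).trans (ih.trans ?_)
      rw [hmass]
      have : (1/2 + c) * massBefore x i k ≤ (1/2 + c) * (massBefore x i k + x i t) :=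
        mul_le_mul_of_nonneg_left (by linarith) (by norm_num [c])
      gcongr
    · rw [hE, not_le] at ht
      rw [max_eq_left (by linarith)] at hfree
      rw [max_eq_right (by linarith)] at ih
      have h1 := hx.Pr_inter_ball t (mem_freeBefore_congr x i t)
        (fun b => b.1 = true ∧ b.2.1 = i)
      have h2 := hx.Pr_inter_ball t (mem_freeBefore_congr x i t)
        (fun b => b.1 = true ∧ b.2.2.1 = i)
      rw [hx.sum_ballWeight_first] at h1
      rw [hx.sum_ballWeight_second] at h2
      have hb : Pr m n p x (freeBefore x i t) * x i t ≤ (1/2 + c) * x i t :=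
        mul_le_mul_of_nonneg_right hfree hx0
      calc _ ≤ _ := hx.Pr_mono (lateBefore_succ_subset x i t)
        _ ≤ _ := hx.Pr_union_le _ _
        _ ≤ Pr m n p x (lateBefore x i k) + ((1/2 + c) * x i t + (1/2 + c) * x i t) :=
          add_le_add le_rfl
            ((hx.Pr_union_le _ _).trans (add_le_add (h1.le.trans hb) (h2.le.trans hb)))
        _ ≤ 2 * ((1/2 + c) * massBefore x i (k + 1) - (1/2 - c)) := by
          rw [hmass]
          linarith
        _ ≤ _ := by
          gcongr
          exact le_max_right _ _

end LPFeasible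

variable (m n)

/-- in the rounding process with LP-feasible `x`, for every bin `i` and
time `t`, the probability that bin `i` is matched along a late edge before time `t`
satisfies `P[O^L_{i,t}] ≤ 4c`. -/
theorem late_occupancy_prob (p : Fin n → ℝ) (x : Fin m → Fin n → ℝ)
    (hx : LPFeasible m n p x) (i : Fin m) (t : Fin n) :
    Pr m n p x (OL m n x i t) ≤ 4 * c := by
  have h := hx.Pr_lateBefore_le i t.2.le
  have hS1 : massBefore x i t ≤ 1 := (Finset.sum_le_sum_of_subset_of_nonneg
    (Finset.filter_subset _ _) fun j _ _ => hx.2.1 i j).trans (hx.2.2.1 i)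
  refine h.trans ?_
  have : max 0 ((1/2 + c) * massBefore x i t - (1/2 - c)) ≤ 2 * c := by
    refine max_le (by norm_num [c]) ?_
    unfold c
    linarith
  linarith

end Rounding
end
end

section
/- In the rounding process with LP-feasible x, for every ball t and every bin j with x_{j,t} > 0, the probability that ball t remains unmatched after the first-pick step, conditioned on t arriving and picking j first, satisfies P[U₁(t) | A_t = 1, I¹_t = j] ≥ 1/2 − c. -/
open Finset

noncomputable section
open scoped Classical

namespace Rounding

variable (m n : ℕ)

section FirstPick

variable {m n}

section Resampling

/-- Resampling identity: if `W` factors through a coordinate `π` that can be freely reset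
by `u`, then any function of `π` is uncorrelated with any function not depending on `π`. -/
theorem sum_mul_eq_of_resample {Ω α : Type*} [Fintype Ω] [Fintype α]
    (u : Ω → α → Ω) (π : Ω → α) (hπu : ∀ ω a, π (u ω a) = a)
    (huπ : ∀ ω a, u (u ω a) (π ω) = ω)
    (R G : Ω → ℝ) (w h : α → ℝ) (hR : ∀ ω a, R (u ω a) = R ω)
    (hG : ∀ ω a, G (u ω a) = G ω) (hw : ∑ a, w a = 1) :
    ∑ ω, R ω * w (π ω) * G ω * h (π ω) =
      (∑ ω, R ω * w (π ω) * G ω) * ∑ a, w a * h a := by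
  have inv : Function.Involutive fun z : Ω × α => (u z.1 z.2, π z.1) := by
    rintro ⟨ω, a⟩
    simp [hπu, huπ]
  calc ∑ ω, R ω * w (π ω) * G ω * h (π ω)
      = ∑ z : Ω × α, R z.1 * w (π z.1) * G z.1 * h (π z.1) * w z.2 := by
        rw [Fintype.sum_prod_type]
        simp [← Finset.mul_sum, hw]
    _ = ∑ z : Ω × α, R z.1 * w (π z.1) * G z.1 * (w z.2 * h z.2) := by
        refine Fintype.sum_equiv inv.toPerm _ _ ?_
        rintro ⟨ω, a⟩
        simp only [Function.Involutive.coe_toPerm, hπu, hR, hG]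
        ring
    _ = _ := by
        rw [Fintype.sum_prod_type, Finset.sum_mul]
        simp [← Finset.mul_sum]

theorem sum_prod_mul₃ {α β γ : Type*} [Fintype α] [Fintype β] [Fintype γ]
    (f : α → ℝ) (g : β → ℝ) (h : γ → ℝ) :
    ∑ z : α × β × γ, f z.1 * g z.2.1 * h z.2.2 = (∑ a, f a) * (∑ b, g b) * ∑ d, h d := by
  simp only [Fintype.sum_prod_type, ← Finset.mul_sum, ← Finset.sum_mul]

theorem sum_prod_mul₄ {α β γ δ : Type*} [Fintype α] [Fintype β] [Fintype γ] [Fintype δ]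
    (f : α → ℝ) (g : β → ℝ) (h : γ → ℝ) (k : δ → ℝ) :
    ∑ z : α × β × γ × δ, f z.1 * g z.2.1 * h z.2.2.1 * k z.2.2.2 =
      (∑ a, f a) * (∑ b, g b) * (∑ d, h d) * ∑ e, k e := by
  simp only [Fintype.sum_prod_type, ← Finset.mul_sum, ← Finset.sum_mul]

end Resampling

section Parameters

variable {p : Fin n → ℝ} {x : Fin m → Fin n → ℝ}

theorem S_le_one (hx : LPFeasible m n p x) (i : Fin m) (t : Fin n) : S m n x i t ≤ 1 :=
  (Finset.sum_le_sum_of_subset_of_nonneg (Finset.filter_subset _ _)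
    fun s _ _ => hx.2.1 i s).trans (hx.2.2.1 i)

theorem denom_pos (hx : LPFeasible m n p x) (i : Fin m) (t : Fin n) :
    0 < 1 - (1/2 + c) * S m n x i t := by
  have := S_le_one hx i t
  unfold c
  linarith

theorem q_nonneg (hx : LPFeasible m n p x) (i : Fin m) (t : Fin n) : 0 ≤ q m n x i t :=
  le_min zero_le_one (div_nonneg (by unfold c; norm_num) (denom_pos hx i t).le)

theorem q_le_one (i : Fin m) (t : Fin n) : q m n x i t ≤ 1 := min_le_left _ _

theorem x_le_one (hx : LPFeasible m n p x) (i : Fin m) (t : Fin n) : x i t ≤ 1 :=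
  (Finset.single_le_sum (fun k _ => hx.2.1 k t) (Finset.mem_univ i)).trans
    ((hx.2.2.2.1 t).trans_le (hx.1 t).2)

theorem sum_div_eq_one (hx : LPFeasible m n p x) (t : Fin n) : ∑ i, x i t / p t = 1 := by
  rw [← Finset.sum_div, hx.2.2.2.1 t, div_self (hx.1 t).1.ne']

theorem weight_nonneg (hx : LPFeasible m n p x) (cfg : Cfg m n) : 0 ≤ weight m n p x cfg := by
  have hpick : ∀ f : Fin n → Fin m, 0 ≤ ∏ t, x (f t) t / p t := fun f =>
    Finset.prod_nonneg fun t _ => div_nonneg (hx.2.1 _ t) (hx.1 t).1.le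
  refine mul_nonneg (mul_nonneg (mul_nonneg ?_ (hpick _)) (hpick _)) ?_
  · refine Finset.prod_nonneg fun t _ => ?_
    split_ifs
    · exact (hx.1 t).1.le
    · exact sub_nonneg.2 (hx.1 t).2
  · refine Finset.prod_nonneg fun i _ => Finset.prod_nonneg fun t _ => ?_
    split_ifs
    · exact q_nonneg hx i t
    · exact sub_nonneg.2 (q_le_one i t)

theorem sum_weight (hx : LPFeasible m n p x) : ∑ cfg, weight m n p x cfg = 1 := by
  have hA : ∑ A : Fin n → Bool, ∏ t, (if A t then p t else 1 - p t) = 1 := by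
    rw [← Fintype.prod_sum fun t (b : Bool) => if b then p t else 1 - p t]
    simp
  have hI : ∑ f : Fin n → Fin m, ∏ t, x (f t) t / p t = 1 := by
    rw [← Fintype.prod_sum fun t i => x i t / p t]
    simp [sum_div_eq_one hx]
  have hY : ∑ Y : Fin m → Fin n → Bool,
      ∏ i, ∏ t, (if Y i t then q m n x i t else 1 - q m n x i t) = 1 := by
    rw [← Fintype.prod_sum fun i (f : Fin n → Bool) =>
      ∏ t, if f t then q m n x i t else 1 - q m n x i t]
    refine Finset.prod_eq_one fun i _ => ?_
    rw [← Fintype.prod_sum fun t (b : Bool) => if b then q m n x i t else 1 - q m n x i t]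
    simp
  have key := sum_prod_mul₄ (fun A : Fin n → Bool => ∏ t, if A t then p t else 1 - p t)
    (fun f : Fin n → Fin m => ∏ t, x (f t) t / p t)
    (fun f : Fin n → Fin m => ∏ t, x (f t) t / p t)
    (fun Y : Fin m → Fin n → Bool =>
      ∏ i, ∏ t, if Y i t then q m n x i t else 1 - q m n x i t)
  rw [hA, hI, hY, mul_one, mul_one, mul_one] at key
  exact key

theorem Pr_mono (hx : LPFeasible m n p x) {E F : Set (Cfg m n)} (h : E ⊆ F) :
    Pr m n p x E ≤ Pr m n p x F := by
  refine Finset.sum_le_sum fun cfg _ => ?_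
  by_cases hE : cfg ∈ E
  · simp [hE, h hE]
  · rw [if_neg hE]
    split_ifs
    · exact weight_nonneg hx cfg
    · exact le_rfl

theorem Pr_sdiff {E F : Set (Cfg m n)} (h : F ⊆ E) :
    Pr m n p x (E \ F) = Pr m n p x E - Pr m n p x F := by
  unfold Pr
  rw [← Finset.sum_sub_distrib]
  refine Finset.sum_congr rfl fun cfg _ => ?_
  by_cases hF : cfg ∈ F
  · simp [hF, h hF]
  · simp [hF]

theorem Pr_univ (hx : LPFeasible m n p x) : Pr m n p x Set.univ = 1 := by
  simpa [Pr] using sum_weight hx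

end Parameters

section Coordinates

/-- The coordinates `(A_t, I¹_t, Y_{j,t})` of a configuration. -/
def coord (j : Fin m) (t : Fin n) (cfg : Cfg m n) : Bool × Fin m × Bool :=
  (cfg.1 t, cfg.2.1 t, cfg.2.2.2 j t)

/-- Reset the coordinates `(A_t, I¹_t, Y_{j,t})` of a configuration. -/
def reset (j : Fin m) (t : Fin n) (cfg : Cfg m n) (z : Bool × Fin m × Bool) : Cfg m n :=
  (Function.update cfg.1 t z.1, Function.update cfg.2.1 t z.2.1, cfg.2.2.1,
    Function.update cfg.2.2.2 j (Function.update (cfg.2.2.2 j) t z.2.2))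

variable {p : Fin n → ℝ} {x : Fin m → Fin n → ℝ}

theorem sum_ite_mul_weight (hx : LPFeasible m n p x) (j : Fin m) (t : Fin n)
    (E : Set (Cfg m n)) (hE : ∀ cfg z, reset j t cfg z ∈ E ↔ cfg ∈ E)
    (h : Bool × Fin m × Bool → ℝ) :
    ∑ cfg, (if cfg ∈ E then weight m n p x cfg else 0) * h (coord j t cfg) =
      Pr m n p x E * ∑ z : Bool × Fin m × Bool,
        (if z.1 then p t else 1 - p t) * (x z.2.1 t / p t) *
          (if z.2.2 then q m n x j t else 1 - q m n x j t) * h z := by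
  let w : Bool × Fin m × Bool → ℝ := fun z =>
    (if z.1 then p t else 1 - p t) * (x z.2.1 t / p t) *
      (if z.2.2 then q m n x j t else 1 - q m n x j t)
  let R : Cfg m n → ℝ := fun cfg =>
    (∏ s ∈ univ.erase t, if cfg.1 s then p s else 1 - p s) *
    (∏ s ∈ univ.erase t, x (cfg.2.1 s) s / p s) *
    (∏ s, x (cfg.2.2.1 s) s / p s) *
    ((∏ i ∈ univ.erase j, ∏ s, if cfg.2.2.2 i s then q m n x i s else 1 - q m n x i s) *
      ∏ s ∈ univ.erase t, if cfg.2.2.2 j s then q m n x j s else 1 - q m n x j s)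
  have hW : ∀ cfg, weight m n p x cfg = R cfg * w (coord j t cfg) := by
    intro cfg
    simp only [weight, R, w, coord]
    rw [← Finset.mul_prod_erase univ (fun s => if cfg.1 s then p s else 1 - p s)
        (Finset.mem_univ t),
      ← Finset.mul_prod_erase univ (fun s => x (cfg.2.1 s) s / p s) (Finset.mem_univ t),
      ← Finset.mul_prod_erase univ (fun i => ∏ s, if cfg.2.2.2 i s then q m n x i s
        else 1 - q m n x i s) (Finset.mem_univ j),
      ← Finset.mul_prod_erase univ (fun s => if cfg.2.2.2 j s then q m n x j s
        else 1 - q m n x j s) (Finset.mem_univ t)]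
    ring
  have hR : ∀ cfg z, R (reset j t cfg z) = R cfg := by
    intro cfg z
    simp only [R, reset]
    congr 1
    · congr 1
      congr 1
      all_goals
        refine Finset.prod_congr rfl fun s hs => ?_
        simp [Function.update_of_ne (Finset.ne_of_mem_erase hs)]
    · congr 1
      · refine Finset.prod_congr rfl fun i hi => ?_
        simp [Function.update_of_ne (Finset.ne_of_mem_erase hi)]
      · refine Finset.prod_congr rfl fun s hs => ?_
        simp [Function.update_of_ne (Finset.ne_of_mem_erase hs)]
  have hw : ∑ z, w z = 1 := by
    have key := sum_prod_mul₃ (fun a : Bool => if a then p t else 1 - p t)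
      (fun i => x i t / p t) (fun b : Bool => if b then q m n x j t else 1 - q m n x j t)
    rw [sum_div_eq_one hx] at key
    refine key.trans ?_
    simp
  have key := sum_mul_eq_of_resample (reset j t) (coord j t)
    (fun cfg z => by simp [reset, coord]) (fun cfg z => by simp [reset, coord])
    R (fun cfg => if cfg ∈ E then 1 else 0) w h hR
    (fun cfg z => by simp only [hE]) hw
  simp only [← hW, mul_ite, mul_one, mul_zero] at key
  exact key

/-- The event that ball `t` arrives and picks bin `j` first is independent of everything
that does not depend on `(A_t, I¹_t, Y_{j,t})`. -/
theorem Pr_inter_pick (hx : LPFeasible m n p x) (j : Fin m) (t : Fin n)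
    (E : Set (Cfg m n)) (hE : ∀ cfg z, reset j t cfg z ∈ E ↔ cfg ∈ E) :
    Pr m n p x (E ∩ (EvA m n t ∩ EvI1 m n j t)) = Pr m n p x E * x j t := by
  have key := sum_ite_mul_weight hx j t E hE (fun z => if z.1 = true ∧ z.2.1 = j then 1 else 0)
  have hp := (hx.1 t).1.ne'
  have hsum : ∑ z : Bool × Fin m × Bool,
      (if z.1 then p t else 1 - p t) * (x z.2.1 t / p t) *
        (if z.2.2 then q m n x j t else 1 - q m n x j t) *
        (if z.1 = true ∧ z.2.1 = j then 1 else 0) = x j t := by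
    simp only [Fintype.sum_prod_type, Fintype.sum_bool]
    simp [Finset.sum_add_distrib]
    field_simp
    ring
  rw [hsum] at key
  rw [← key]
  refine Finset.sum_congr rfl fun cfg _ => ?_
  have hF : cfg ∈ EvA m n t ∩ EvI1 m n j t ↔
      (coord j t cfg).1 = true ∧ (coord j t cfg).2.1 = j := Iff.rfl
  rw [Set.mem_inter_iff, hF]
  by_cases h1 : cfg ∈ E <;>
    by_cases h2 : (coord j t cfg).1 = true ∧ (coord j t cfg).2.1 = j <;> simp [h1, h2]

/-- The event that ball `t` arrives, picks bin `j` first and has its coin for `j` come up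
heads is independent of everything that does not depend on `(A_t, I¹_t, Y_{j,t})`. -/
theorem Pr_inter_accept (hx : LPFeasible m n p x) (j : Fin m) (t : Fin n)
    (E : Set (Cfg m n)) (hE : ∀ cfg z, reset j t cfg z ∈ E ↔ cfg ∈ E) :
    Pr m n p x (E ∩ {cfg | coord j t cfg = (true, j, true)}) =
      Pr m n p x E * (x j t * q m n x j t) := by
  have key := sum_ite_mul_weight hx j t E hE (fun z => if z = (true, j, true) then 1 else 0)
  have hp := (hx.1 t).1.ne'
  have hsum : ∑ z : Bool × Fin m × Bool,
      (if z.1 then p t else 1 - p t) * (x z.2.1 t / p t) *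
        (if z.2.2 then q m n x j t else 1 - q m n x j t) *
        (if z = (true, j, true) then 1 else 0) = x j t * q m n x j t := by
    simp only [mul_ite, mul_one, mul_zero, Finset.sum_ite_eq', Finset.mem_univ, if_true]
    field_simp
  rw [hsum] at key
  rw [← key]
  refine Finset.sum_congr rfl fun cfg _ => ?_
  simp only [Set.mem_inter_iff, Set.mem_ofPred_eq, mul_ite, mul_one, mul_zero]
  by_cases h1 : cfg ∈ E <;> simp [h1]

end Coordinates

section Dynamics

variable {p : Fin n → ℝ} {x : Fin m → Fin n → ℝ}

theorem lt_of_mem_proc {cfg : Cfg m n} {i : Fin m} {s : Fin n} {k : ℕ}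
    (h : (i, s) ∈ (proc m n x cfg k).1) : s.1 < k := by
  induction k with
  | zero => simp [proc] at h
  | succ k ih =>
    simp only [proc] at h
    split_ifs at h
    · rcases Finset.mem_insert.1 h with h | h
      · rw [(Prod.mk.inj h).2]
        exact Nat.lt_succ_self k
      · exact (ih h).trans (Nat.lt_succ_self k)
    all_goals exact (ih h).trans (Nat.lt_succ_self k)

theorem proc_subset_succ (cfg : Cfg m n) (k : ℕ) :
    (proc m n x cfg k).1 ∪ (proc m n x cfg k).2 ⊆
      (proc m n x cfg (k + 1)).1 ∪ (proc m n x cfg (k + 1)).2 := by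
  simp only [proc]
  split_ifs
  · exact Finset.union_subset_union (Finset.subset_insert _ _) subset_rfl
  · exact Finset.union_subset_union subset_rfl (Finset.subset_insert _ _)
  all_goals exact subset_rfl

/-- The process before time `t` does not depend on the randomness of time `t`. -/
theorem proc_reset (j : Fin m) (t : Fin n) (cfg : Cfg m n) (z : Bool × Fin m × Bool)
    {k : ℕ} (hk : k ≤ t.1) : proc m n x (reset j t cfg z) k = proc m n x cfg k := by
  induction k with
  | zero => rfl
  | succ k ih =>
    have hne : ∀ h : k < n, (⟨k, h⟩ : Fin n) ≠ t := fun h e => by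
      have := congrArg Fin.val e
      simp only at this
      omega
    have hY : ∀ (i : Fin m) (h : k < n),
        (reset j t cfg z).2.2.2 i ⟨k, h⟩ = cfg.2.2.2 i ⟨k, h⟩ := by
      intro i h
      by_cases hi : i = j
      · subst hi
        simp [reset, Function.update_of_ne (hne h)]
      · simp [reset, Function.update_of_ne hi]
    have hA : ∀ h : k < n, (reset j t cfg z).1 ⟨k, h⟩ = cfg.1 ⟨k, h⟩ := fun h =>
      Function.update_of_ne (hne h) _ _
    have hI : ∀ h : k < n, (reset j t cfg z).2.1 ⟨k, h⟩ = cfg.2.1 ⟨k, h⟩ := fun h =>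
      Function.update_of_ne (hne h) _ _
    have hI₂ : (reset j t cfg z).2.2.1 = cfg.2.2.1 := rfl
    simp only [proc, ih (by omega), hA, hI, hI₂, hY]

theorem reset_mem_V (j : Fin m) (t : Fin n) (cfg : Cfg m n) (z : Bool × Fin m × Bool) :
    reset j t cfg z ∈ V m n x j t ↔ cfg ∈ V m n x j t := by
  simp only [V, Set.mem_ofPred_eq, proc_reset j t cfg z le_rfl]

/-- A free bin that is picked first, with its coin up heads, gets matched. -/
theorem freeBin_succ_subset (j : Fin m) (t : Fin n) :
    {cfg | FreeBin m n ((proc m n x cfg (t.1 + 1)).1 ∪ (proc m n x cfg (t.1 + 1)).2) j} ⊆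
      V m n x j t \ (V m n x j t ∩ {cfg | coord j t cfg = (true, j, true)}) := by
  intro cfg h
  have hV : cfg ∈ V m n x j t := fun s hs => h s (proc_subset_succ cfg t.1 hs)
  refine ⟨hV, fun hc => h t ?_⟩
  obtain ⟨hA, hI, hY⟩ : cfg.1 t = true ∧ cfg.2.1 t = j ∧ cfg.2.2.2 j t = true := by
    simpa [coord] using hc.2
  have hfree : FreeBin m n ((proc m n x cfg t.1).1 ∪ (proc m n x cfg t.1).2) j := hV
  simp [proc, hA, hI, hY, hfree]

theorem pick_sdiff_subset_U1 (j : Fin m) (t : Fin n) :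
    (EvA m n t ∩ EvI1 m n j t) \ (V m n x j t ∩ {cfg | coord j t cfg = (true, j, true)}) ⊆
      U1 m n x t ∩ (EvA m n t ∩ EvI1 m n j t) := by
  rintro cfg ⟨hF, hc⟩
  refine ⟨fun i hi => ?_, hF⟩
  have hA : cfg.1 t = true := hF.1
  have hI : cfg.2.1 t = j := hF.2
  simp only [proc, t.2, dite_true, Fin.eta, hA, hI, true_and] at hi
  split_ifs at hi with h₁ h₂
  · exact hc ⟨h₁.1, by simp [coord, hA, hI, h₁.2]⟩
  all_goals exact (lt_of_mem_proc hi).false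

/-- The probability that bin `j` is free is at most `max (1 - (1/2 + c) S) (1/2 + c)`. -/
theorem Pr_freeBin_le (hx : LPFeasible m n p x) (j : Fin m) {k : ℕ} (hk : k ≤ n) :
    Pr m n p x {cfg | FreeBin m n ((proc m n x cfg k).1 ∪ (proc m n x cfg k).2) j} ≤
      max (1 - (1/2 + c) * ∑ s ∈ univ.filter (fun s : Fin n => s.1 < k), x j s) (1/2 + c) := by
  induction k with
  | zero => simpa [Pr_univ hx] using Or.inl (Pr_mono hx (Set.subset_univ _))
  | succ k ih =>
    let t : Fin n := ⟨k, hk⟩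
    have ih : Pr m n p x (V m n x j t) ≤ max (1 - (1/2 + c) * S m n x j t) (1/2 + c) :=
      ih (Nat.le_of_succ_le hk)
    have hS : ∑ s ∈ univ.filter (fun s : Fin n => s.1 < k + 1), x j s = S m n x j t + x j t := by
      have : univ.filter (fun s : Fin n => s.1 < k + 1) =
          insert t (univ.filter fun s : Fin n => s < t) := by
        ext s
        simp [t, Fin.lt_def, Fin.ext_iff]
        omega
      rw [this, Finset.sum_insert (by simp), add_comm, S]
    have step := Pr_mono hx (freeBin_succ_subset (x := x) j t)
    rw [Pr_sdiff Set.inter_subset_left,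
      Pr_inter_accept hx j t _ (reset_mem_V j t)] at step
    refine step.trans ?_
    rw [hS]
    have hq := q_nonneg hx j t
    have hx0 := hx.2.1 j t
    have hxq : x j t * q m n x j t ≤ 1 :=
      mul_le_one₀ (x_le_one hx j t) hq (q_le_one j t)
    have hxq0 := mul_nonneg hx0 hq
    have hD := denom_pos hx j t
    have ha : (0 : ℝ) < 1/2 + c := by unfold c; norm_num
    rcases le_total (1/2 + c) (1 - (1/2 + c) * S m n x j t) with h | h
    · rw [max_eq_left h] at ih
      have hqe : q m n x j t * (1 - (1/2 + c) * S m n x j t) = 1/2 + c := by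
        rw [q, min_eq_right ((div_le_one hD).2 h), div_mul_cancel₀ _ hD.ne']
      refine le_max_of_le_left ?_
      calc _ = Pr m n p x (V m n x j t) * (1 - x j t * q m n x j t) := by ring
        _ ≤ (1 - (1/2 + c) * S m n x j t) * (1 - x j t * q m n x j t) :=
          mul_le_mul_of_nonneg_right ih (sub_nonneg.2 hxq)
        _ = 1 - (1/2 + c) * S m n x j t -
            x j t * (q m n x j t * (1 - (1/2 + c) * S m n x j t)) := by ring
        _ = _ := by rw [hqe]; ring
    · rw [max_eq_right h] at ih
      refine le_max_of_le_right (le_trans (sub_le_self _ (mul_nonneg ?_ hxq0)) ih)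
      exact Finset.sum_nonneg fun cfg _ => ite_nonneg (weight_nonneg hx cfg) le_rfl

/-- Bin `j` is free and accepts ball `t` with probability at most `1/2 + c`. -/
theorem Pr_V_mul_q_le (hx : LPFeasible m n p x) (j : Fin m) (t : Fin n) :
    Pr m n p x (V m n x j t) * q m n x j t ≤ 1/2 + c := by
  have hV : Pr m n p x (V m n x j t) ≤ max (1 - (1/2 + c) * S m n x j t) (1/2 + c) :=
    Pr_freeBin_le hx j t.2.le
  have hD := denom_pos hx j t
  refine (mul_le_mul_of_nonneg_right hV (q_nonneg hx j t)).trans ?_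
  rcases le_total (1/2 + c) (1 - (1/2 + c) * S m n x j t) with h | h
  · rw [max_eq_left h, q, min_eq_right ((div_le_one hD).2 h), mul_div_cancel₀ _ hD.ne']
  · rw [max_eq_right h]
    exact mul_le_of_le_one_right (by unfold c; norm_num) (q_le_one j t)

end Dynamics

end FirstPick

/-- in the rounding process with LP-feasible `x`, for every ball `t` and
every bin `j` with `x_{j,t} > 0`, the probability that ball `t` remains unmatched after
the first-pick step, conditioned on `t` arriving and picking `j` first, satisfies
`P[U₁(t) | A_t = 1, I¹_t = j] ≥ 1/2 − c`. -/
theorem unmatched_after_first_pick (p : Fin n → ℝ) (x : Fin m → Fin n → ℝ)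
    (hx : LPFeasible m n p x) (t : Fin n) (j : Fin m) (hj : 0 < x j t) :
    1/2 - c ≤ condPr m n p x (U1 m n x t) (EvA m n t ∩ EvI1 m n j t) := by
  have hsub : V m n x j t ∩ {cfg | coord j t cfg = (true, j, true)} ⊆
      EvA m n t ∩ EvI1 m n j t := by
    rintro cfg ⟨-, hc⟩
    obtain ⟨hA, hI, -⟩ : cfg.1 t = true ∧ cfg.2.1 t = j ∧ cfg.2.2.2 j t = true := by
      simpa [coord] using hc
    exact ⟨hA, hI⟩
  have hle := Pr_mono hx (pick_sdiff_subset_U1 (x := x) j t)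
  have hF := Pr_inter_pick hx j t Set.univ (by simp)
  rw [Set.univ_inter, Pr_univ hx, one_mul] at hF
  rw [Pr_sdiff hsub, Pr_inter_accept hx j t _ (reset_mem_V j t), hF] at hle
  rw [condPr, hF, le_div_iff₀ hj]
  have hVq := mul_le_mul_of_nonneg_left (Pr_V_mul_q_le hx j t) hj.le
  linarith

end Rounding
end
end

section
/- (Lossless single-bin rounding) Consider one bin and balls t = 1,…,n, where ball t independently takes realization r ∈ R_t (a finite set) with probability p_{t,r} (∑_{r∈R_t} p_{t,r} ≤ 1). Let y_{t,r} ≥ 0 satisfy y_{t,r} ≤ p_{t,r}·(1 − ∑_{t'<t} ∑_{r'} y_{t',r'}) for all t, r, and suppose ∑_{t'<t} ∑_{r'} y_{t',r'} < 1 for every t. Run the following process: independently sample the realization of each ball; process balls in order, and at time t, if the bin is still unmatched and ball t realized r, match the bin to ball t with probability y_{t,r}/(p_{t,r}·(1 − ∑_{t'<t} ∑_{r'} y_{t',r'})) (using fresh independent randomness). Then for every t and r, the probability that the bin is matched at time t and ball t realized r equals exactly y_{t,r}; consequently, the probability that the bin is still unmatched before time t equals 1 − ∑_{t'<t} ∑_{r'}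 y_{t',r'}. -/
open Finset

noncomputable section
open scoped Classical

namespace SingleBin

/-- A configuration of the randomness: the realization of each ball (`none` meaning the
ball takes no realization), and the independent acceptance coins, one for each pair of
a ball and a possible realization. -/
abbrev Cfg (n : ℕ) (k : Fin n → ℕ) :=
  (∀ t : Fin n, Option (Fin (k t))) × (∀ t : Fin n, Fin (k t) → Bool)

variable (n : ℕ) (k : Fin n → ℕ)

/-- `Ysum y t = ∑_{t' < t} ∑_{r'} y t' r'`. -/
def Ysum (y : ∀ t : Fin n, Fin (k t) → ℝ) (t : Fin n) : ℝ :=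
  ∑ t' ∈ Finset.univ.filter fun t' : Fin n => t' < t, ∑ r', y t' r'

/-- The acceptance probability `y_{t,r} / (p_{t,r}·(1 − ∑_{t'<t} ∑_{r'} y_{t',r'}))`. -/
def acc (p y : ∀ t : Fin n, Fin (k t) → ℝ) (t : Fin n) (r : Fin (k t)) : ℝ :=
  y t r / (p t r * (1 - Ysum n k y t))

/-- The probability of a configuration: the product of the probabilities of the
mutually independent realizations (realization `r` of ball `t` with probability
`p_{t,r}`, no realization with probability `1 − ∑_r p_{t,r}`) and acceptance coins. -/
def weight (p y : ∀ t : Fin n, Fin (k t) → ℝ) (cfg : Cfg n k) : ℝ :=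
  (∏ t, match cfg.1 t with
    | some r => p t r
    | none => 1 - ∑ r, p t r) *
  ∏ t, ∏ r, if cfg.2 t r then acc n k p y t r else 1 - acc n k p y t r

/-- Probability of an event. -/
def Pr (p y : ∀ t : Fin n, Fin (k t) → ℝ) (E : Set (Cfg n k)) : ℝ :=
  ∑ cfg : Cfg n k, if cfg ∈ E then weight n k p y cfg else 0

/-- The bin is matched at some time `< t`: processing balls in order, the bin is
matched the first time some ball `t'` realizes some `r` and the corresponding
acceptance coin comes up heads. -/
def matchedBefore (cfg : Cfg n k) : ℕ → Prop
  | 0 => False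
  | (t + 1) => matchedBefore cfg t ∨
      ∃ h : t < n, ∃ r, cfg.1 ⟨t, h⟩ = some r ∧ cfg.2 ⟨t, h⟩ r = true

/-- The factor of `weight` contributed by a single ball. -/
def ballWeight (p y : ∀ t : Fin n, Fin (k t) → ℝ) (t : Fin n)
    (o : Option (Fin (k t))) (c : Fin (k t) → Bool) : ℝ :=
  (match o with
    | some r => p t r
    | none => 1 - ∑ r, p t r) *
  ∏ r, if c r then acc n k p y t r else 1 - acc n k p y t r

theorem sum_coins {ι : Type*} [Fintype ι] [DecidableEq ι] (a : ι → ℝ) :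
    ∑ c : ι → Bool, ∏ j, (if c j = true then a j else 1 - a j) = 1 := by
  rw [← Fintype.prod_sum (fun j (b : Bool) => if b = true then a j else 1 - a j)]
  simp

theorem sum_coins_of_eq {ι : Type*} [Fintype ι] [DecidableEq ι] (a : ι → ℝ) (i : ι) (b : Bool) :
    ∑ c : ι → Bool, (if c i = b then ∏ j, (if c j = true then a j else 1 - a j) else 0) =
      if b = true then a i else 1 - a i := by
  have h : ∀ c : ι → Bool,
      (if c i = b then ∏ j, (if c j = true then a j else 1 - a j) else 0) =
        ∏ j, (if j = i ∧ c j ≠ b then 0 else if c j = true then a j else 1 - a j) := by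
    intro c
    split_ifs with hc
    · refine Finset.prod_congr rfl fun j _ => (if_neg ?_).symm
      rintro ⟨rfl, h⟩
      exact h hc
    · refine (Finset.prod_eq_zero (Finset.mem_univ i) ?_).symm
      rw [if_pos ⟨rfl, hc⟩]
  simp_rw [h]
  rw [← Fintype.prod_sum
    (fun j (x : Bool) => if j = i ∧ x ≠ b then 0 else if x = true then a j else 1 - a j)]
  rw [Fintype.prod_eq_single i]
  · cases b <;> simp
  · intro j hj
    simp [hj]

theorem Pr_forall (p y : ∀ t : Fin n, Fin (k t) → ℝ)
    (A : ∀ t : Fin n, Option (Fin (k t)) → (Fin (k t) → Bool) → Prop) (E : Set (Cfg n k))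
    (hE : ∀ cfg, cfg ∈ E ↔ ∀ t, A t (cfg.1 t) (cfg.2 t)) :
    Pr n k p y E =
      ∏ t, ∑ o, ∑ c, if A t o c then ballWeight n k p y t o c else 0 := by
  have h : ∀ cfg : Cfg n k,
      (if cfg ∈ E then weight n k p y cfg else 0) =
        ∏ t, if A t (cfg.1 t) (cfg.2 t) then ballWeight n k p y t (cfg.1 t) (cfg.2 t) else 0 := by
    intro cfg
    split_ifs with hc
    · rw [weight, ← Finset.prod_mul_distrib]
      exact Finset.prod_congr rfl fun t _ => (if_pos ((hE cfg).1 hc t)).symm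
    · simp only [hE, not_forall] at hc
      obtain ⟨t, ht⟩ := hc
      exact (Finset.prod_eq_zero (Finset.mem_univ t) (if_neg ht)).symm
  rw [Pr, Finset.sum_congr rfl fun cfg _ => h cfg, Fintype.sum_prod_type, Fintype.prod_sum]
  refine Finset.sum_congr rfl fun x _ => ?_
  rw [Fintype.prod_sum]

theorem sum_ballWeight (p y : ∀ t : Fin n, Fin (k t) → ℝ) (t : Fin n) :
    ∑ o, ∑ c, ballWeight n k p y t o c = 1 := by
  simp [ballWeight, ← Finset.mul_sum, sum_coins, Fintype.sum_option]

theorem sum_ballWeight_accept (p y : ∀ t : Fin n, Fin (k t) → ℝ) (t : Fin n) (r : Fin (k t)) :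
    (∑ o, ∑ c, if o = some r ∧ c r = true then ballWeight n k p y t o c else 0) =
      p t r * acc n k p y t r := by
  rw [Fintype.sum_eq_single (some r)]
  · have h := sum_coins_of_eq (acc n k p y t) r true
    simp only [if_true] at h
    rw [← h, Finset.mul_sum]
    refine Finset.sum_congr rfl fun c _ => ?_
    simp [ballWeight]
  · intro o ho
    simp [ho]

theorem sum_ballWeight_reject (p y : ∀ t : Fin n, Fin (k t) → ℝ) (t : Fin n) :
    (∑ o, ∑ c, if ¬ ∃ r, o = some r ∧ c r = true then ballWeight n k p y t o c else 0) =
      1 - ∑ r, p t r * acc n k p y t r := by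
  have h : ∀ r, (∑ c, if ¬ ∃ r', some r = some r' ∧ c r' = true then
      ballWeight n k p y t (some r) c else 0) = p t r * (1 - acc n k p y t r) := by
    intro r
    have h := sum_coins_of_eq (acc n k p y t) r false
    simp only [Bool.false_eq_true, if_false] at h
    rw [← h, Finset.mul_sum]
    refine Finset.sum_congr rfl fun c _ => ?_
    simp [ballWeight]
  rw [Fintype.sum_option, Finset.sum_congr rfl fun r _ => h r]
  simp [ballWeight, ← Finset.mul_sum, sum_coins, mul_sub]

theorem matchedBefore_iff (cfg : Cfg n k) (m : ℕ) :
    matchedBefore n k cfg m ↔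
      ∃ s : Fin n, s.1 < m ∧ ∃ r, cfg.1 s = some r ∧ cfg.2 s r = true := by
  induction m with
  | zero => simp [matchedBefore]
  | succ m ih =>
    rw [matchedBefore, ih]
    constructor
    · rintro (⟨s, hs, h⟩ | ⟨hm, h⟩)
      · exact ⟨s, by omega, h⟩
      · exact ⟨⟨m, hm⟩, by simp, h⟩
    · rintro ⟨s, hs, h⟩
      rcases Nat.lt_succ_iff_lt_or_eq.mp hs with hs | rfl
      · exact Or.inl ⟨s, hs, h⟩
      · exact Or.inr ⟨s.2, h⟩

/-- If every factor is `1 - S s / (1 - ∑_{s' < s} S s')`, the product telescopes. -/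
theorem prod_one_sub_div (S : Fin n → ℝ)
    (hS : ∀ t, ∑ s ∈ Finset.univ.filter (fun s : Fin n => s < t), S s < 1) (m : ℕ) (hm : m ≤ n) :
    ∏ s ∈ Finset.univ.filter (fun s : Fin n => s.1 < m),
        (1 - S s / (1 - ∑ s' ∈ Finset.univ.filter (fun s' : Fin n => s' < s), S s')) =
      1 - ∑ s ∈ Finset.univ.filter (fun s : Fin n => s.1 < m), S s := by
  induction m with
  | zero => simp
  | succ m ih =>
    have hins : Finset.univ.filter (fun s : Fin n => s.1 < m + 1) =
        insert ⟨m, hm⟩ (Finset.univ.filter (fun s : Fin n => s.1 < m)) := by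
      ext s
      simp only [Finset.mem_filter, Finset.mem_univ, true_and, Finset.mem_insert, Fin.ext_iff]
      omega
    have hfil : Finset.univ.filter (fun s : Fin n => s < ⟨m, hm⟩) =
        Finset.univ.filter (fun s : Fin n => s.1 < m) := by
      ext s
      simp [Fin.lt_def]
    have hlt := hS ⟨m, hm⟩
    rw [hfil] at hlt
    rw [hins, Finset.prod_insert (by simp), Finset.sum_insert (by simp), ih (by omega), hfil]
    have hne : 1 - ∑ s ∈ Finset.univ.filter (fun s : Fin n => s.1 < m), S s ≠ 0 := by linarith
    field_simp
    ring

theorem mul_acc (p y : ∀ t : Fin n, Fin (k t) → ℝ)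
    (hy0 : ∀ t r, 0 ≤ y t r)
    (hyc : ∀ t r, y t r ≤ p t r * (1 - Ysum n k y t)) (t : Fin n) (r : Fin (k t)) :
    p t r * acc n k p y t r = y t r / (1 - Ysum n k y t) := by
  rw [acc]
  by_cases hp : p t r = 0
  · have h : y t r = 0 := le_antisymm (by simpa [hp] using hyc t r) (hy0 t r)
    simp [hp, h]
  · rw [← mul_div_assoc, mul_div_mul_left _ _ hp]

theorem prod_reject (p y : ∀ t : Fin n, Fin (k t) → ℝ)
    (hy0 : ∀ t r, 0 ≤ y t r)
    (hyc : ∀ t r, y t r ≤ p t r * (1 - Ysum n k y t))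
    (hY1 : ∀ t, Ysum n k y t < 1) (t : Fin n) :
    ∏ s ∈ Finset.univ.filter (fun s : Fin n => s < t), (1 - ∑ r, p s r * acc n k p y s r) =
      1 - Ysum n k y t := by
  simp_rw [mul_acc n k p y hy0 hyc, ← Finset.sum_div]
  exact prod_one_sub_div n (fun s => ∑ r, y s r) hY1 t.1 t.2.le

/-- Lossless single-bin rounding: with `y_{t,r} ≥ 0` satisfying
`y_{t,r} ≤ p_{t,r}·(1 − ∑_{t'<t} ∑_{r'} y_{t',r'})` and `∑_{t'<t} ∑_{r'} y_{t',r'} < 1`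
for all `t`, the process that, at each time `t`, if the bin is unmatched and ball `t`
realized `r`, matches the bin to ball `t` with probability
`y_{t,r}/(p_{t,r}·(1 − ∑_{t'<t} ∑_{r'} y_{t',r'}))` satisfies: the probability that the
bin is matched at time `t` with ball `t` realizing `r` is exactly `y_{t,r}`, and the
probability that the bin is still unmatched before time `t` is exactly
`1 − ∑_{t'<t} ∑_{r'} y_{t',r'}`. -/
theorem lossless_single_bin_rounding
    (p y : ∀ t : Fin n, Fin (k t) → ℝ)
    (hp0 : ∀ t r, 0 ≤ p t r) (hp1 : ∀ t, ∑ r, p t r ≤ 1)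
    (hy0 : ∀ t r, 0 ≤ y t r)
    (hyc : ∀ t r, y t r ≤ p t r * (1 - Ysum n k y t))
    (hY1 : ∀ t, Ysum n k y t < 1) :
    ∀ (t : Fin n) (r : Fin (k t)),
      Pr n k p y {cfg | ¬ matchedBefore n k cfg t.1 ∧
          cfg.1 t = some r ∧ cfg.2 t r = true} = y t r ∧
      Pr n k p y {cfg | ¬ matchedBefore n k cfg t.1} = 1 - Ysum n k y t := by
  intro t r
  constructor
  · obtain ⟨A, hA⟩ : ∃ A : ∀ s : Fin n, Option (Fin (k s)) → (Fin (k s) → Bool) → Prop,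
        ∀ s o c, A s o c ↔ (s < t → ¬ ∃ r', o = some r' ∧ c r' = true) ∧
          (s = t → ∃ r' : Fin (k s), r'.1 = r.1 ∧ o = some r' ∧ c r' = true) :=
      ⟨_, fun _ _ _ => Iff.rfl⟩
    rw [Pr_forall n k p y A]
    swap
    · intro cfg
      simp only [hA, Set.mem_ofPred_eq, matchedBefore_iff]
      constructor
      · rintro ⟨hno, hr⟩ s
        refine ⟨fun hs h => hno ⟨s, hs, h⟩, ?_⟩
        rintro rfl
        exact ⟨r, rfl, hr⟩
      · intro h
        refine ⟨fun ⟨s, hs, hs'⟩ => (h s).1 hs hs', ?_⟩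
        obtain ⟨r', hr', h'⟩ := (h t).2 rfl
        rwa [Fin.ext hr'] at h'
    rw [← Finset.mul_prod_erase _ _ (Finset.mem_univ t)]
    have ht : (∑ o, ∑ c, if A t o c then ballWeight n k p y t o c else 0) = y t r / (1 - Ysum n k y t) := by
      rw [← mul_acc n k p y hy0 hyc, ← sum_ballWeight_accept]
      refine Finset.sum_congr rfl fun o _ => Finset.sum_congr rfl fun c _ => ?_
      simp [hA, ← Fin.ext_iff]
    have hs : ∀ s ∈ Finset.univ.erase t,
        (∑ o, ∑ c, if A s o c then ballWeight n k p y s o c else 0) =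
        if s < t then 1 - ∑ r, p s r * acc n k p y s r else 1 := by
      intro s hs
      have hne : s ≠ t := Finset.ne_of_mem_erase hs
      split_ifs with hlt
      · rw [← sum_ballWeight_reject]
        simp [hA, hne, hlt]
      · rw [← sum_ballWeight n k p y s]
        simp [hA, hne, hlt]
    rw [ht, Finset.prod_congr rfl hs, ← Finset.prod_filter, Finset.filter_erase,
      Finset.erase_eq_of_notMem (by simp), prod_reject n k p y hy0 hyc hY1]
    exact div_mul_cancel₀ _ (by linarith [hY1 t])
  · rw [Pr_forall n k p y (fun s o c => s < t → ¬ ∃ r', o = some r' ∧ c r' = true)]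
    swap
    · intro cfg
      simp only [Set.mem_ofPred_eq, matchedBefore_iff, Fin.lt_def]
      exact ⟨fun h s hs hs' => h ⟨s, hs, hs'⟩, fun h ⟨s, hs, hs'⟩ => h s hs hs'⟩
    rw [← prod_reject n k p y hy0 hyc hY1, Finset.prod_filter]
    refine Finset.prod_congr rfl fun s _ => ?_
    split_ifs with hlt
    · rw [← sum_ballWeight_reject]
      simp [hlt]
    · rw [← sum_ballWeight n k p y s]
      simp [hlt]

end SingleBin
end
end

section
/- For the gap instance I: (a) the expected maximum weight of a matching in the realized weighted bipartite graph equals 7/4; and (b) the solution given by y_{k,k,r⁺} = 1/2 for k ∈ {1,2} (where r⁺ denotes the nonzero realization of ball k) and y_{1,3} = y_{2,3} = 1/2 (ball 3 has a single realization) is feasible for LP-Match-Gen on I with objective value 2. Consequently, the optimal value of LP-Match-Gen on I is at least (8/7) times the expected maximum matching weight; in particular, it is at least (8/7) times the expected weight obtained by any algorithm, online or offline. -/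
open Finset

noncomputable section
open scoped Classical

namespace GapInstance

/-! The gap instance `I`: two bins `{0,1}` and three balls `{0,1,2}`.  For `k ∈ {0,1}`,
ball `k` has two equiprobable realizations: realization `1` (the nonzero realization
`r⁺`) gives weight `1` to the edge to bin `k` and weight `0` to the other bin, and
realization `0` gives both edges weight `0`.  Ball `2` has a single realization (of
probability `1`) giving both of its edges weight `1`. -/

/-- Number of realizations of each ball. -/
def nR : Fin 3 → ℕ := ![2, 2, 1]

/-- Probability of each realization of each ball. -/
def pr (t : Fin 3) (_ : Fin (nR t)) : ℝ := if t.1 < 2 then 1/2 else 1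

/-- Realized edge weights: ball `2` always has weight-1 edges to both bins; for
`t ∈ {0,1}`, the edge from bin `t` to ball `t` has weight `1` exactly in the nonzero
realization `1`, and all other edge weights are `0`. -/
def w (i : Fin 2) (t : Fin 3) (r : Fin (nR t)) : ℝ :=
  if t.1 = 2 then 1 else if i.1 = t.1 ∧ r.1 = 1 then 1 else 0

/-- The LP solution from the statement: `y_{k,k,r⁺} = 1/2` for `k ∈ {0,1}` and
`y_{i,2} = 1/2` for both bins `i`. -/
def y (i : Fin 2) (t : Fin 3) (r : Fin (nR t)) : ℝ :=
  if t.1 = 2 then 1/2 else if i.1 = t.1 ∧ r.1 = 1 then 1/2 else 0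

/-- A joint realization of all three balls. -/
abbrev Profile := ∀ t : Fin 3, Fin (nR t)

/-- Probability of a joint realization (balls are independent). -/
def prob (ω : Profile) : ℝ := ∏ t, pr t (ω t)

/-- A partial assignment of balls to bins is a matching if no two balls get the same
bin. -/
def IsMatching (f : Fin 3 → Option (Fin 2)) : Prop :=
  ∀ t t' i, f t = some i → f t' = some i → t = t'

/-- The weight of an assignment under a joint realization `ω`. -/
def matchWeight (f : Fin 3 → Option (Fin 2)) (ω : Profile) : ℝ :=
  ∑ t, match f t with
    | some i => w i t (ω t)
    | none => 0

/-- Feasibility for LP-Match-Gen on the gap instance. -/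
def Feasible (z : ∀ (_ : Fin 2) (t : Fin 3), Fin (nR t) → ℝ) : Prop :=
  (∀ i t r, 0 ≤ z i t r) ∧
  (∀ i : Fin 2, ∑ t, ∑ r, z i t r ≤ 1) ∧
  (∀ (t : Fin 3) (r : Fin (nR t)), ∑ i, z i t r ≤ pr t r) ∧
  (∀ (i : Fin 2) (t : Fin 3) (r : Fin (nR t)),
    z i t r ≤ pr t r *
      (1 - ∑ t' ∈ Finset.univ.filter fun t' : Fin 3 => t' < t, ∑ r', z i t' r'))

/-- The LP-Match-Gen objective. -/
def objective (z : ∀ (_ : Fin 2) (t : Fin 3), Fin (nR t) → ℝ) : ℝ :=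
  ∑ i, ∑ t, ∑ r, w i t r * z i t r

theorem sum_realizations_zero (g : Fin (nR 0) → ℝ) :
    ∑ r, g r = g (0 : Fin 2) + g (1 : Fin 2) :=
  Fin.sum_univ_two g

theorem sum_realizations_one (g : Fin (nR 1) → ℝ) :
    ∑ r, g r = g (0 : Fin 2) + g (1 : Fin 2) :=
  Fin.sum_univ_two g

theorem sum_realizations_two (g : Fin (nR 2) → ℝ) : ∑ r, g r = g (0 : Fin 1) :=
  Fin.sum_univ_one g

theorem w_le_one (i : Fin 2) (t : Fin 3) (r : Fin (nR t)) : w i t r ≤ 1 := by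
  unfold w; split_ifs <;> norm_num

theorem feasible_y : Feasible y := by
  refine ⟨fun i t r => ?_, fun i => ?_, fun t r => ?_, fun i t r => ?_⟩
  · unfold y; split_ifs <;> norm_num
  · rw [Fin.sum_univ_three, sum_realizations_zero, sum_realizations_one, sum_realizations_two]
    fin_cases i <;> norm_num [y]
  · rw [Fin.sum_univ_two]
    fin_cases t <;> simp only [y, pr] <;> norm_num <;> split_ifs <;> norm_num
  · rw [Finset.sum_filter, Fin.sum_univ_three, sum_realizations_zero, sum_realizations_one,
      sum_realizations_two]
    fin_cases i <;> fin_cases t <;> simp [y, pr] <;> (try split_ifs) <;> norm_num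

theorem objective_y : objective y = 2 := by
  simp only [objective, Fin.sum_univ_two, Fin.sum_univ_three, sum_realizations_zero,
    sum_realizations_one, sum_realizations_two]
  norm_num [y, w]

theorem objective_le_two {z : ∀ (_ : Fin 2) (t : Fin 3), Fin (nR t) → ℝ} (hz : Feasible z) :
    objective z ≤ 2 := by
  calc objective z ≤ ∑ i, ∑ t, ∑ r, z i t r := by
        unfold objective
        gcongr with i _ t _ r _
        exact mul_le_of_le_one_left (hz.1 i t r) (w_le_one i t r)
    _ ≤ ∑ _i : Fin 2, (1 : ℝ) := Finset.sum_le_sum fun i _ => hz.2.1 i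
    _ = 2 := by norm_num

/-- The maximum weight of a matching: both bins can be filled with weight-`1` edges unless
every ball is in its realization `0`. -/
def maxWeight (ω : Profile) : ℝ := 2 - ∏ t, if (ω t).1 = 0 then 1 else 0

theorem realization_cases (ω : Profile) :
    ((ω 0).1 = 0 ∨ (ω 0).1 = 1) ∧ ((ω 1).1 = 0 ∨ (ω 1).1 = 1) ∧ (ω 2).1 = 0 :=
  ⟨Nat.le_one_iff_eq_zero_or_eq_one.mp (Nat.lt_succ_iff.mp (ω 0).2),
    Nat.le_one_iff_eq_zero_or_eq_one.mp (Nat.lt_succ_iff.mp (ω 1).2),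
    Nat.lt_one_iff.mp (ω 2).2⟩

theorem matchWeight_le_maxWeight {f : Fin 3 → Option (Fin 2)} (hf : IsMatching f)
    (ω : Profile) : matchWeight f ω ≤ maxWeight ω := by
  have h01 := hf 0 1
  have h02 := hf 0 2
  have h12 := hf 1 2
  obtain ⟨h0, h1, h2⟩ := realization_cases ω
  simp only [matchWeight, maxWeight, Fin.sum_univ_three, Fin.prod_univ_three, w]
  generalize f 0 = a at *
  generalize f 1 = b at *
  generalize f 2 = c at *
  rcases h0 with h0 | h0 <;> rcases h1 with h1 | h1 <;> simp only [h0, h1, h2] <;>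
    rcases a with _ | a <;> rcases b with _ | b <;> rcases c with _ | c <;>
    simp at h01 h02 h12 ⊢ <;> grind

theorem exists_matchWeight_eq_maxWeight (ω : Profile) :
    ∃ f, IsMatching f ∧ maxWeight ω = matchWeight f ω := by
  obtain ⟨h0, h1, h2⟩ := realization_cases ω
  rcases h0 with h0 | h0
  · let f : Fin 3 → Option (Fin 2) := ![none, some 1, some 0]
    have hf : f 0 = none ∧ f 1 = some 1 ∧ f 2 = some 0 := ⟨rfl, rfl, rfl⟩
    refine ⟨f, by unfold IsMatching; decide, ?_⟩
    rcases h1 with h1 | h1 <;>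
      norm_num [matchWeight, maxWeight, Fin.sum_univ_three, Fin.prod_univ_three, w, hf, h0, h1, h2]
  · let f : Fin 3 → Option (Fin 2) := ![some 0, none, some 1]
    have hf : f 0 = some 0 ∧ f 1 = none ∧ f 2 = some 1 := ⟨rfl, rfl, rfl⟩
    refine ⟨f, by unfold IsMatching; decide, ?_⟩
    norm_num [matchWeight, maxWeight, Fin.sum_univ_three, Fin.prod_univ_three, w, hf, h0, h2]

theorem isGreatest_maxWeight (ω : Profile) :
    IsGreatest {v : ℝ | ∃ f, IsMatching f ∧ v = matchWeight f ω} (maxWeight ω) := by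
  refine ⟨exists_matchWeight_eq_maxWeight ω, ?_⟩
  rintro _ ⟨f, hf, rfl⟩
  exact matchWeight_le_maxWeight hf ω

/-- Expectations of products of functions of the individual balls factor. -/
theorem sum_prob_mul_prod (g : ∀ t, Fin (nR t) → ℝ) :
    ∑ ω : Profile, prob ω * ∏ t, g t (ω t) = ∏ t, ∑ r, pr t r * g t r := by
  simp only [prob, ← Finset.prod_mul_distrib]
  exact (Fintype.prod_sum fun t r => pr t r * g t r).symm

theorem sum_prob : ∑ ω : Profile, prob ω = 1 := by
  have h := sum_prob_mul_prod fun _ _ => 1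
  simp only [Finset.prod_const_one, mul_one] at h
  rw [h, Fin.prod_univ_three, sum_realizations_zero, sum_realizations_one, sum_realizations_two]
  norm_num [pr]

theorem expected_maxWeight : ∑ ω : Profile, prob ω * maxWeight ω = 7/4 := by
  simp only [maxWeight, mul_sub, Finset.sum_sub_distrib, ← Finset.sum_mul, sum_prob]
  rw [sum_prob_mul_prod fun t r => if r.1 = 0 then 1 else 0, Fin.prod_univ_three,
    sum_realizations_zero, sum_realizations_one, sum_realizations_two]
  norm_num [pr]

/-- for the gap instance: (a) the expected maximum weight of a matching
in the realized graph equals `7/4`; (b) the solution `y` is feasible for LP-Match-Gen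
with objective value `2`; consequently, the optimal value of LP-Match-Gen is at least
`8/7` times the expected maximum matching weight. -/
theorem gap_instance :
    ∃ maxw : Profile → ℝ,
      (∀ ω, IsGreatest {v : ℝ | ∃ f, IsMatching f ∧ v = matchWeight f ω} (maxw ω)) ∧
      (∑ ω : Profile, prob ω * maxw ω = 7/4) ∧
      (Feasible y ∧ objective y = 2) ∧
      8/7 * (∑ ω : Profile, prob ω * maxw ω) ≤
        sSup {v : ℝ | ∃ z, Feasible z ∧ v = objective z} := by
  refine ⟨maxWeight, isGreatest_maxWeight, expected_maxWeight, ⟨feasible_y, objective_y⟩, ?_⟩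
  rw [expected_maxWeight]
  have hbdd : BddAbove {v : ℝ | ∃ z, Feasible z ∧ v = objective z} := by
    refine ⟨2, ?_⟩
    rintro _ ⟨z, hz, rfl⟩
    exact objective_le_two hz
  calc (8/7 * (7/4) : ℝ) = objective y := by rw [objective_y]; norm_num
    _ ≤ _ := le_csSup hbdd ⟨y, feasible_y, rfl⟩

end GapInstance
end
end
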